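/- Let (μ_n)_{n≥1} be a sequence of probability measures on ℝ, each with infinite support and all moments finite, with orthonormal polynomial leading coefficients γ_j^{(n)}, and assume (1/n)(γ_{n−1}^{(n)}/γ_n^{(n)})² → 0 as n → ∞. Then for every uniformly continuous bounded f : ℝ → ℝ, the variance of the linear statistic of the OPE of size n associated with μ_n satisfies Var X_f^{(n)} = o(n) as n → ∞. -/

import Mathlib

open MeasureTheory ProbabilityTheory Filter Topology

noncomputable section

/-- The squared Vandermonde determinant `∏_{i>j} (λ_i - λ_j)^2`. -/
def vandSq {n : ℕ} (l : Fin n → ℝ) : ℝ :=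
  ∏ q ∈ Finset.univ.filter (fun q : Fin n × Fin n => q.2 < q.1), (l q.1 - l q.2) ^ 2

/-- The orthogonal polynomial ensemble of size `n` associated with `μ`: the probability
measure on `ℝ^n` proportional to `∏_{i>j}(λ_i-λ_j)^2 dμ(λ_1)⋯dμ(λ_n)`. -/
def OPE (μ : Measure ℝ) (n : ℕ) : Measure (Fin n → ℝ) :=
  ((((Measure.pi fun _ : Fin n => μ).withDensity fun l => ENNReal.ofReal (vandSq l))
    Set.univ)⁻¹) •
    ((Measure.pi fun _ : Fin n => μ).withDensity fun l => ENNReal.ofReal (vandSq l))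

/-- The linear statistic `X_f = ∑ f(λ_j)`. -/
def linStat {n : ℕ} (f : ℝ → ℝ) (l : Fin n → ℝ) : ℝ := ∑ j, f (l j)

/-- The scaled linear statistic `X_{f,α,x*} = ∑ f(n^α (λ_j - x*))`. -/
def scaledLinStat {n : ℕ} (f : ℝ → ℝ) (α xs : ℝ) (l : Fin n → ℝ) : ℝ :=
  ∑ j, f ((n : ℝ) ^ α * (l j - xs))

/-- `p` is the family of orthonormal polynomials of `μ`: `p j` has degree `j`, positive
leading coefficient, and `∫ p_i p_j dμ = δ_{ij}`. -/
def IsOrthonormalPolys (μ : Measure ℝ) (p : ℕ → Polynomial ℝ) : Prop :=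
  (∀ j, (p j).degree = (j : WithBot ℕ)) ∧ (∀ j, 0 < (p j).leadingCoeff) ∧
    ∀ i j, ∫ x, (p i).eval x * (p j).eval x ∂μ = if i = j then 1 else 0

/-- All moments of `μ` are finite. -/
def HasAllMoments (μ : Measure ℝ) : Prop := ∀ k : ℕ, Integrable (fun x : ℝ => x ^ k) μ

/-- `μ` has infinite support: no finite set carries full `μ`-measure. -/
def InfiniteSupport (μ : Measure ℝ) : Prop := ∀ s : Finset ℝ, μ ((↑s : Set ℝ)ᶜ) ≠ 0

/-- The Christoffel–Darboux kernel `K_n(x,y) = ∑_{j<n} p_j(x) p_j(y)`. -/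
def CDKernel (p : ℕ → Polynomial ℝ) (n : ℕ) (x y : ℝ) : ℝ :=
  ∑ j ∈ Finset.range n, (p j).eval x * (p j).eval y

/-- The sup norm `‖f‖_∞` of a (bounded) function. -/
def supNorm (f : ℝ → ℝ) : ℝ := ⨆ x, |f x|

/-- The (topological) support of a measure on `ℝ`. -/
def measSupport (μ : Measure ℝ) : Set ℝ := {x | ∀ U ∈ 𝓝 x, μ U ≠ 0}

/-- The sine kernel `sin(πt)/(πt)` (equal to `1` at `t = 0`). -/
def sineKernel (t : ℝ) : ℝ := if t = 0 then 1 else Real.sin (Real.pi * t) / (Real.pi * t)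

/-- `K̃_n(x,y) = w(x)^{1/2} w(y)^{1/2} K_n(x,y)`, where `w` is the Radon–Nikodym
derivative of `μ` with respect to Lebesgue measure. -/
def tildeK (μ : Measure ℝ) (Kf : ℝ → ℝ → ℝ) (x y : ℝ) : ℝ :=
  Real.sqrt ((μ.rnDeriv volume x).toReal) * Real.sqrt ((μ.rnDeriv volume y).toReal) * Kf x y

/-- The Nevai condition at `x*` for a sequence of measures with kernels `Kf n`. -/
def NevaiCond (μ : ℕ → Measure ℝ) (Kf : ℕ → ℝ → ℝ → ℝ) (xs : ℝ) : Prop :=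
  ∀ f : ℝ → ℝ, Continuous f → HasCompactSupport f →
    Tendsto (fun n => ∫ y, (f y - f xs) * Kf n xs y ^ 2 / Kf n xs xs ∂(μ n)) atTop (𝓝 0)

/-- The `α`-Nevai condition at `x*` for a sequence of measures with kernels `Kf n`. -/
def AlphaNevaiCond (μ : ℕ → Measure ℝ) (Kf : ℕ → ℝ → ℝ → ℝ) (α xs : ℝ) : Prop :=
  ∀ f : ℝ → ℝ, Continuous f → HasCompactSupport f →
    ∀ S : Set ℝ, IsCompact S →
      TendstoUniformlyOn
        (fun n s => ∫ y, (f s - f ((n : ℝ) ^ α * (y - xs))) *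
            Kf n (xs + s / (n : ℝ) ^ α) y ^ 2 /
            Kf n (xs + s / (n : ℝ) ^ α) (xs + s / (n : ℝ) ^ α) ∂(μ n))
        (fun _ => 0) atTop S

section DeterminantalMoments

open Equiv

variable {n : ℕ}

/-- A permutation sum in which all rows but the `a`-th are rows of the identity matrix. -/
lemma sum_perm_eq_of_single (N : Fin n → Fin n → ℝ) (a : Fin n)
    (hN : ∀ i, i ≠ a → ∀ k, N i k = if i = k then 1 else 0) :
    ∑ ρ : Perm (Fin n), ((Perm.sign ρ : ℤ) : ℝ) * ∏ i, N i (ρ i) = N a a := by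
  rw [Finset.sum_eq_single (1 : Perm (Fin n))]
  · simp only [Perm.sign_one, Units.val_one, Int.cast_one, one_mul, Perm.coe_one, id]
    rw [Finset.prod_eq_single a (fun i _ hi => by simp [hN i hi]) (by simp)]
  · intro ρ _ hρ
    have : ∃ i, i ≠ a ∧ ρ i ≠ i := by
      by_contra! h
      refine hρ (Equiv.ext fun i => ?_)
      by_cases hi : i = a
      · subst hi
        by_contra hne
        exact hne (ρ.injective (h _ hne))
      · exact h i hi
    obtain ⟨i, hia, hi⟩ := this
    rw [Finset.prod_eq_zero (Finset.mem_univ i), mul_zero]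
    rw [hN i hia, if_neg (Ne.symm hi)]
  · simp

/-- A permutation sum in which all rows but the `a`-th and `b`-th are rows of the identity
matrix. -/
lemma sum_perm_eq_of_pair (N : Fin n → Fin n → ℝ) {a b : Fin n} (hab : a ≠ b)
    (hN : ∀ i, i ≠ a → i ≠ b → ∀ k, N i k = if i = k then 1 else 0) :
    ∑ ρ : Perm (Fin n), ((Perm.sign ρ : ℤ) : ℝ) * ∏ i, N i (ρ i)
      = N a a * N b b - N a b * N b a := by
  have hprod : ∀ ρ : Perm (Fin n), (∀ i, i ≠ a → i ≠ b → ρ i = i) →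
      ∏ i, N i (ρ i) = N a (ρ a) * N b (ρ b) := by
    intro ρ hρ
    rw [← Finset.prod_pair (f := fun i => N i (ρ i)) hab]
    symm
    refine Finset.prod_subset (Finset.subset_univ _) fun i _ hi => ?_
    simp only [Finset.mem_insert, Finset.mem_singleton, not_or] at hi
    rw [hN i hi.1 hi.2, hρ i hi.1 hi.2, if_pos rfl]
  have hne : (1 : Perm (Fin n)) ≠ swap a b := by
    intro h
    have := congrArg (fun e : Perm (Fin n) => e a) h
    simp at this
    exact hab this
  rw [← Finset.sum_subset (Finset.subset_univ {1, swap a b}), Finset.sum_pair hne,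
    hprod 1 (by simp), hprod (swap a b) (fun i h h' => swap_apply_of_ne_of_ne h h')]
  · simp [Perm.sign_swap hab]
    ring
  · intro ρ _ hρ
    simp only [Finset.mem_insert, Finset.mem_singleton, not_or] at hρ
    have : ∃ i, i ≠ a ∧ i ≠ b ∧ ρ i ≠ i := by
      by_contra! h
      have key : ∀ x, ρ x = a ∨ ρ x = b ∨ ρ x = x := by
        intro x
        by_cases h1 : ρ x = a
        · exact Or.inl h1
        by_cases h2 : ρ x = b
        · exact Or.inr (Or.inl h2)
        exact Or.inr (Or.inr (ρ.injective (h _ h1 h2)))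
      rcases eq_or_ne (ρ a) a with ha | ha
      · refine hρ.1 (Equiv.ext fun i => ?_)
        by_cases hia : i = a
        · subst hia; exact ha
        by_cases hib : i = b
        · subst hib
          rcases key i with h1 | h1 | h1
          · exact absurd (ρ.injective (h1.trans ha.symm)) hia
          · exact h1
          · exact h1
        · exact h i hia hib
      · have hab' : ρ a = b := by
          rcases key a with h1 | h1 | h1
          · exact absurd h1 ha
          · exact h1
          · exact absurd h1 ha
        refine hρ.2 (Equiv.ext fun i => ?_)
        by_cases hia : i = a
        · subst hia; rw [hab', swap_apply_left]
        by_cases hib : i = b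
        · subst hib
          rw [swap_apply_right]
          rcases key i with h1 | h1 | h1
          · exact h1
          · exact absurd (ρ.injective (h1.trans hab'.symm)) hia
          · exact absurd (ρ.injective (h1.trans hab'.symm)) hia
        · rw [h i hia hib, swap_apply_of_ne_of_ne hia hib]
    obtain ⟨i, hia, hib, hi⟩ := this
    rw [Finset.prod_eq_zero (Finset.mem_univ i), mul_zero]
    rw [hN i hia hib, if_neg (Ne.symm hi)]

variable {μ : Measure ℝ} [IsProbabilityMeasure μ]

lemma prod_mul_det_sq (φ g : Fin n → ℝ → ℝ) (l : Fin n → ℝ) :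
    (∏ i, g i (l i)) * (Matrix.of fun j i => φ j (l i)).det ^ 2
      = ∑ σ : Perm (Fin n), ∑ τ : Perm (Fin n),
        (((Perm.sign σ : ℤ) : ℝ) * ((Perm.sign τ : ℤ) : ℝ)) *
          ∏ i, (g i (l i) * (φ (σ i) (l i) * φ (τ i) (l i))) := by
  rw [Matrix.det_apply', sq, Finset.sum_mul_sum, Finset.mul_sum]
  refine Finset.sum_congr rfl fun σ _ => ?_
  rw [Finset.mul_sum]
  refine Finset.sum_congr rfl fun τ _ => ?_
  simp only [Matrix.of_apply, Finset.prod_mul_distrib]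
  ring

lemma integrable_prod_mul_det_sq (φ g : Fin n → ℝ → ℝ)
    (hg : ∀ i j k, Integrable (fun x => g i x * (φ j x * φ k x)) μ) :
    Integrable (fun l : Fin n → ℝ =>
      (∏ i, g i (l i)) * (Matrix.of fun j i => φ j (l i)).det ^ 2) (Measure.pi fun _ => μ) := by
  simp only [prod_mul_det_sq]
  refine integrable_finsetSum _ fun σ _ => integrable_finsetSum _ fun τ _ => ?_
  exact (Integrable.fintype_prod
    (f := fun i x => g i x * (φ (σ i) x * φ (τ i) x)) fun i => hg i _ _).const_mul _

lemma integral_prod_mul_det_sq (φ g : Fin n → ℝ → ℝ)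
    (hg : ∀ i j k, Integrable (fun x => g i x * (φ j x * φ k x)) μ) :
    ∫ l : Fin n → ℝ, (∏ i, g i (l i)) * (Matrix.of fun j i => φ j (l i)).det ^ 2
        ∂(Measure.pi fun _ => μ)
      = ∑ σ : Perm (Fin n), ∑ ρ : Perm (Fin n), ((Perm.sign ρ : ℤ) : ℝ) *
          ∏ i, ∫ x, g i x * (φ (σ i) x * φ (σ (ρ i)) x) ∂μ := by
  have hi : ∀ σ τ : Perm (Fin n), Integrable (fun l : Fin n → ℝ =>
      (((Perm.sign σ : ℤ) : ℝ) * ((Perm.sign τ : ℤ) : ℝ)) *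
          ∏ i, (g i (l i) * (φ (σ i) (l i) * φ (τ i) (l i)))) (Measure.pi fun _ => μ) :=
    fun σ τ => (Integrable.fintype_prod
      (f := fun i x => g i x * (φ (σ i) x * φ (τ i) x)) fun i => hg i _ _).const_mul _
  simp only [prod_mul_det_sq]
  rw [integral_finsetSum _ fun σ _ => integrable_finsetSum _ fun τ _ => hi σ τ]
  refine Finset.sum_congr rfl fun σ _ => ?_
  rw [integral_finsetSum _ fun τ _ => hi σ τ, ← Equiv.sum_comp (Equiv.mulLeft σ)]
  refine Finset.sum_congr rfl fun ρ _ => ?_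
  rw [integral_const_mul, integral_fintype_prod_eq_prod
    (fun i x => g i x * (φ (σ i) x * φ ((Equiv.mulLeft σ ρ) i) x))]
  congr 1
  rcases Int.units_eq_one_or (Perm.sign σ) with h | h <;> simp [h]

variable {φ : Fin n → ℝ → ℝ}

lemma integral_det_sq (hφ : ∀ j k, Integrable (fun x => φ j x * φ k x) μ)
    (ho : ∀ j k, ∫ x, φ j x * φ k x ∂μ = if j = k then 1 else 0) :
    ∫ l : Fin n → ℝ, (Matrix.of fun j i => φ j (l i)).det ^ 2 ∂(Measure.pi fun _ => μ)
      = (n.factorial : ℝ) := by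
  have h := integral_prod_mul_det_sq (μ := μ) φ (fun _ _ => 1) (fun _ j k => by simpa using hφ j k)
  simp only [Finset.prod_const_one, one_mul] at h
  rw [h]
  trans ∑ σ : Perm (Fin n), (1 : ℝ)
  · refine Finset.sum_congr rfl fun σ _ => ?_
    rw [Finset.sum_eq_single (1 : Perm (Fin n))]
    · simp [ho]
    · intro ρ _ hρ
      obtain ⟨i, hi⟩ : ∃ i, ρ i ≠ i := by
        by_contra! h
        exact hρ (Equiv.ext h)
      rw [Finset.prod_eq_zero (Finset.mem_univ i), mul_zero]
      rw [ho, if_neg fun h => hi (σ.injective h).symm]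
    · simp
  · simp [Fintype.card_perm]

lemma integral_apply_mul_det_sq (hφ : ∀ j k, Integrable (fun x => φ j x * φ k x) μ)
    (ho : ∀ j k, ∫ x, φ j x * φ k x ∂μ = if j = k then 1 else 0) (h : ℝ → ℝ)
    (hh : ∀ j k, Integrable (fun x => h x * (φ j x * φ k x)) μ) (a : Fin n) :
    Integrable (fun l : Fin n → ℝ => h (l a) * (Matrix.of fun j i => φ j (l i)).det ^ 2)
        (Measure.pi fun _ => μ) ∧
    ∫ l : Fin n → ℝ, h (l a) * (Matrix.of fun j i => φ j (l i)).det ^ 2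
        ∂(Measure.pi fun _ => μ)
      = ∑ σ : Perm (Fin n), ∫ x, h x * (φ (σ a) x * φ (σ a) x) ∂μ := by
  set g : Fin n → ℝ → ℝ := fun i => if i = a then h else fun _ => 1 with hg
  have hgi : ∀ i j k, Integrable (fun x => g i x * (φ j x * φ k x)) μ := by
    intro i j k
    by_cases hi : i = a
    · simpa [hg, hi] using hh j k
    · simpa [hg, hi] using hφ j k
  have hp : ∀ l : Fin n → ℝ, ∏ i, g i (l i) = h (l a) := by
    intro l
    rw [Finset.prod_eq_single a (fun i _ hi => by simp [hg, hi]) (by simp)]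
    simp [hg]
  have h1 := integrable_prod_mul_det_sq φ g hgi
  have h2 := integral_prod_mul_det_sq φ g hgi
  simp only [hp] at h1 h2
  refine ⟨h1, h2.trans (Finset.sum_congr rfl fun σ _ => ?_)⟩
  rw [sum_perm_eq_of_single (fun i k => ∫ x, g i x * (φ (σ i) x * φ (σ k) x) ∂μ) a]
  · simp [hg]
  · intro i hi k
    simp [hg, hi, ho, σ.injective.eq_iff]

lemma integral_apply_mul_apply_mul_det_sq
    (hφ : ∀ j k, Integrable (fun x => φ j x * φ k x) μ)
    (ho : ∀ j k, ∫ x, φ j x * φ k x ∂μ = if j = k then 1 else 0) (h : ℝ → ℝ)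
    (hh : ∀ j k, Integrable (fun x => h x * (φ j x * φ k x)) μ) {a b : Fin n} (hab : a ≠ b) :
    Integrable (fun l : Fin n → ℝ =>
      h (l a) * h (l b) * (Matrix.of fun j i => φ j (l i)).det ^ 2) (Measure.pi fun _ => μ) ∧
    ∫ l : Fin n → ℝ, h (l a) * h (l b) * (Matrix.of fun j i => φ j (l i)).det ^ 2
        ∂(Measure.pi fun _ => μ)
      = ∑ σ : Perm (Fin n), ((∫ x, h x * (φ (σ a) x * φ (σ a) x) ∂μ) *
          (∫ x, h x * (φ (σ b) x * φ (σ b) x) ∂μ) - (∫ x, h x * (φ (σ a) x * φ (σ b) x) ∂μ) ^ 2)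
      := by
  set g : Fin n → ℝ → ℝ := fun i => if i = a ∨ i = b then h else fun _ => 1 with hg
  have hgi : ∀ i j k, Integrable (fun x => g i x * (φ j x * φ k x)) μ := by
    intro i j k
    by_cases hi : i = a ∨ i = b
    · simpa [hg, hi] using hh j k
    · simpa [hg, hi] using hφ j k
  have hp : ∀ l : Fin n → ℝ, ∏ i, g i (l i) = h (l a) * h (l b) := by
    intro l
    have := Finset.prod_pair (f := fun i => g i (l i)) hab
    rw [← Finset.prod_subset (Finset.subset_univ {a, b}), this]
    · simp [hg]
    · intro i _ hi
      simp only [Finset.mem_insert, Finset.mem_singleton] at hi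
      simp [hg, hi]
  have h1 := integrable_prod_mul_det_sq φ g hgi
  have h2 := integral_prod_mul_det_sq φ g hgi
  simp only [hp] at h1 h2
  refine ⟨h1, h2.trans (Finset.sum_congr rfl fun σ _ => ?_)⟩
  rw [sum_perm_eq_of_pair (fun i k => ∫ x, g i x * (φ (σ i) x * φ (σ k) x) ∂μ) hab]
  · have hc : ∫ x, h x * (φ (σ b) x * φ (σ a) x) ∂μ = ∫ x, h x * (φ (σ a) x * φ (σ b) x) ∂μ :=
      integral_congr_ae (ae_of_all _ fun x => by ring)
    simp [hg, hc]
    ring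
  · intro i hi hi' k
    simp [hg, hi, hi', ho, σ.injective.eq_iff]

lemma integral_linStat_mul_det_sq (hφ : ∀ j k, Integrable (fun x => φ j x * φ k x) μ)
    (ho : ∀ j k, ∫ x, φ j x * φ k x ∂μ = if j = k then 1 else 0) (h : ℝ → ℝ)
    (hh : ∀ j k, Integrable (fun x => h x * (φ j x * φ k x)) μ) :
    ∫ l : Fin n → ℝ, linStat h l * (Matrix.of fun j i => φ j (l i)).det ^ 2
        ∂(Measure.pi fun _ => μ)
      = n.factorial * ∑ j, ∫ x, h x * (φ j x * φ j x) ∂μ := by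
  simp only [linStat, Finset.sum_mul]
  rw [integral_finsetSum _ fun a _ => (integral_apply_mul_det_sq hφ ho h hh a).1]
  simp only [fun a => (integral_apply_mul_det_sq hφ ho h hh a).2]
  rw [Finset.sum_comm]
  simp only [fun σ : Perm (Fin n) =>
    Equiv.sum_comp σ fun j => ∫ x, h x * (φ j x * φ j x) ∂μ]
  simp [Fintype.card_perm]

lemma integral_linStat_sq_mul_det_sq (hφ : ∀ j k, Integrable (fun x => φ j x * φ k x) μ)
    (ho : ∀ j k, ∫ x, φ j x * φ k x ∂μ = if j = k then 1 else 0) (h : ℝ → ℝ)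
    (hh : ∀ j k, Integrable (fun x => h x * (φ j x * φ k x)) μ)
    (hh2 : ∀ j k, Integrable (fun x => h x ^ 2 * (φ j x * φ k x)) μ) :
    ∫ l : Fin n → ℝ, linStat h l ^ 2 * (Matrix.of fun j i => φ j (l i)).det ^ 2
        ∂(Measure.pi fun _ => μ)
      = n.factorial * (∑ j, ∫ x, h x ^ 2 * (φ j x * φ j x) ∂μ
          + (∑ j, ∫ x, h x * (φ j x * φ j x) ∂μ) ^ 2
          - ∑ j, ∑ k, (∫ x, h x * (φ j x * φ k x) ∂μ) ^ 2) := by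
  set A : Fin n → Fin n → ℝ := fun j k => ∫ x, h x * (φ j x * φ k x) ∂μ with hA
  set B : Fin n → ℝ := fun j => ∫ x, h x ^ 2 * (φ j x * φ j x) ∂μ with hB
  have key : ∀ a b : Fin n, Integrable (fun l : Fin n → ℝ =>
        h (l a) * h (l b) * (Matrix.of fun j i => φ j (l i)).det ^ 2) (Measure.pi fun _ => μ) ∧
      ∫ l : Fin n → ℝ, h (l a) * h (l b) * (Matrix.of fun j i => φ j (l i)).det ^ 2
        ∂(Measure.pi fun _ => μ)
      = ∑ σ : Perm (Fin n), ((if a = b then B (σ a) else 0) +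
          (A (σ a) (σ a) * A (σ b) (σ b) - A (σ a) (σ b) ^ 2)) := by
    intro a b
    by_cases hab : a = b
    · subst hab
      have := integral_apply_mul_det_sq hφ ho (fun x => h x ^ 2) hh2 a
      simp only [hB, ← sq, if_true, sub_self, add_zero]
      simpa only [← sq] using this
    · simpa [hab] using integral_apply_mul_apply_mul_det_sq hφ ho h hh hab
  have hexp : ∀ l : Fin n → ℝ, linStat h l ^ 2 * (Matrix.of fun j i => φ j (l i)).det ^ 2
      = ∑ a, ∑ b, h (l a) * h (l b) * (Matrix.of fun j i => φ j (l i)).det ^ 2 := by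
    intro l
    rw [linStat, sq, Finset.sum_mul_sum, Finset.sum_mul]
    simp only [Finset.sum_mul]
  simp only [hexp]
  rw [integral_finsetSum _ fun a _ => integrable_finsetSum _ fun b _ => (key a b).1]
  simp only [fun a => integral_finsetSum Finset.univ fun b _ => (key a b).1,
    fun a b => (key a b).2]
  simp only [Finset.sum_comm (s := (Finset.univ : Finset (Fin n)))
    (t := (Finset.univ : Finset (Perm (Fin n))))]
  have hσ : ∀ σ : Perm (Fin n), ∑ a, ∑ b, ((if a = b then B (σ a) else 0) +
          (A (σ a) (σ a) * A (σ b) (σ b) - A (σ a) (σ b) ^ 2))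
      = ∑ j, B j + (∑ j, A j j) ^ 2 - ∑ j, ∑ k, A j k ^ 2 := by
    intro σ
    have h1 : ∀ j, ∑ b, A j (σ b) ^ 2 = ∑ k, A j k ^ 2 :=
      fun j => Equiv.sum_comp σ fun k => A j k ^ 2
    have h2 : ∑ a, A (σ a) (σ a) = ∑ j, A j j := Equiv.sum_comp σ fun k => A k k
    have h3 : ∑ a, B (σ a) = ∑ j, B j := Equiv.sum_comp σ B
    have h4 : ∑ a, ∑ k, A (σ a) k ^ 2 = ∑ j, ∑ k, A j k ^ 2 :=
      Equiv.sum_comp σ fun j => ∑ k, A j k ^ 2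
    simp only [Finset.sum_add_distrib, Finset.sum_sub_distrib, Finset.sum_ite_eq,
      Finset.mem_univ, if_true, h1, h3, h4, ← Finset.sum_mul_sum, h2]
    ring
  simp only [hσ]
  rw [Finset.sum_const, nsmul_eq_mul, Finset.card_univ, Fintype.card_perm, Fintype.card_fin]

end DeterminantalMoments

section Variance

variable {n : ℕ} {μ : Measure ℝ}

lemma vandSq_eq_det_vandermonde_sq (l : Fin n → ℝ) :
    vandSq l = (Matrix.vandermonde l).det ^ 2 := by
  rw [Matrix.det_vandermonde, vandSq, Finset.prod_pow]
  congr 1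
  rw [Finset.prod_sigma']
  refine Finset.prod_bij' (fun q _ => ⟨q.2, q.1⟩) (fun q _ => (q.2, q.1)) ?_ ?_ ?_ ?_ ?_ <;> simp

lemma det_eval_sq_eq_mul_vandSq {p : ℕ → Polynomial ℝ} (hp : IsOrthonormalPolys μ p)
    (l : Fin n → ℝ) :
    (Matrix.of fun j i : Fin n => (p j).eval (l i)).det ^ 2
      = (Matrix.of fun i j : Fin n => (p j).coeff i).det ^ 2 * vandSq l := by
  have h := Matrix.eval_matrixOfPolynomials_eq_vandermonde_mul_matrixOfPolynomials l
    (fun j : Fin n => p j)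
    (fun i => (Polynomial.natDegree_eq_of_degree_eq_some (hp.1 i)).le)
  have h' : (Matrix.of fun j i : Fin n => (p j).eval (l i)).det
      = (Matrix.of fun i j : Fin n => (p j).eval (l i)).det := by
    rw [← Matrix.det_transpose]
    rfl
  rw [h', h, Matrix.det_mul, vandSq_eq_det_vandermonde_sq]
  ring

lemma integrable_eval (hmom : HasAllMoments μ) (q : Polynomial ℝ) :
    Integrable (fun x => q.eval x) μ := by
  simp only [Polynomial.eval_eq_sum_range]
  exact integrable_finsetSum _ fun k _ => (hmom k).const_mul _

lemma continuous_vandSq : Continuous (vandSq : (Fin n → ℝ) → ℝ) := by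
  unfold vandSq
  fun_prop

lemma vandSq_nonneg (l : Fin n → ℝ) : 0 ≤ vandSq l :=
  Finset.prod_nonneg fun _ _ => sq_nonneg _

lemma integrable_bdd_mul_eval_mul_eval (hmom : HasAllMoments μ) {h : ℝ → ℝ}
    (hm : Measurable h) {C : ℝ} (hC : ∀ x, |h x| ≤ C) (q r : Polynomial ℝ) :
    Integrable (fun x => h x * (q.eval x * r.eval x)) μ :=
  Integrable.bdd_mul (by simpa using integrable_eval hmom (q * r))
    hm.aestronglyMeasurable (ae_of_all _ hC)

lemma integrable_bdd_sq_mul_eval_mul_eval (hmom : HasAllMoments μ) {h : ℝ → ℝ}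
    (hm : Measurable h) {C : ℝ} (hC : ∀ x, |h x| ≤ C) (q r : Polynomial ℝ) :
    Integrable (fun x => h x ^ 2 * (q.eval x * r.eval x)) μ :=
  integrable_bdd_mul_eval_mul_eval hmom (hm.pow_const 2) (C := C ^ 2)
    (fun x => by rw [abs_pow]; exact pow_le_pow_left₀ (abs_nonneg _) (hC x) 2) q r

variable [IsProbabilityMeasure μ]

/-- The orthogonal polynomial ensemble is a probability measure, with density
`(n!)⁻¹ det(p_j(λ_i))²`. -/
lemma isProbabilityMeasure_OPE_and_integral_OPE (hmom : HasAllMoments μ) {p : ℕ → Polynomial ℝ}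
    (hp : IsOrthonormalPolys μ p) (n : ℕ) :
    IsProbabilityMeasure (OPE μ n) ∧ ∀ G : (Fin n → ℝ) → ℝ,
      ∫ l, G l ∂(OPE μ n) = (n.factorial : ℝ)⁻¹ *
        ∫ l, G l * (Matrix.of fun j i : Fin n => (p j).eval (l i)).det ^ 2
          ∂(Measure.pi fun _ => μ) := by
  set c : ℝ := (Matrix.of fun i j : Fin n => (p j).coeff i).det ^ 2 with hc
  have hφ : ∀ j k : Fin n, Integrable (fun x => (p j).eval x * (p k).eval x) μ := fun j k => by
    simpa using integrable_eval hmom (p j * p k)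
  have ho : ∀ j k : Fin n, ∫ x, (p j).eval x * (p k).eval x ∂μ = if j = k then 1 else 0 :=
    fun j k => by simpa [Fin.ext_iff] using hp.2.2 j k
  have hD := integral_det_sq (φ := fun j : Fin n => fun x => (p j).eval x) hφ ho
  simp only [det_eval_sq_eq_mul_vandSq hp, integral_const_mul, ← hc] at hD ⊢
  have hfac : (0 : ℝ) < n.factorial := by exact_mod_cast n.factorial_pos
  have hc0 : 0 < c := lt_of_le_of_ne (sq_nonneg _) fun h => by
    rw [← h, zero_mul] at hD
    exact hfac.ne hD
  set I : ℝ := ∫ l, vandSq l ∂(Measure.pi fun _ : Fin n => μ) with hI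
  have hI0 : 0 < I := pos_of_mul_pos_right (hD ▸ hfac) hc0.le
  have hintegrable : Integrable (vandSq : (Fin n → ℝ) → ℝ) (Measure.pi fun _ => μ) := by
    by_contra h
    exact hI0.ne' (integral_undef h)
  have hZ : ((Measure.pi fun _ : Fin n => μ).withDensity fun l => ENNReal.ofReal (vandSq l))
      Set.univ = ENNReal.ofReal I := by
    rw [withDensity_apply _ MeasurableSet.univ, Measure.restrict_univ, hI,
      ofReal_integral_eq_lintegral_ofReal hintegrable (ae_of_all _ vandSq_nonneg)]
  refine ⟨⟨?_⟩, fun G => ?_⟩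
  · rw [OPE, Measure.smul_apply, hZ, smul_eq_mul]
    exact ENNReal.inv_mul_cancel (by simpa using hI0) ENNReal.ofReal_ne_top
  · rw [OPE, integral_smul_measure, hZ, integral_withDensity_eq_integral_toReal_smul
      continuous_vandSq.measurable.ennreal_ofReal (ae_of_all _ fun _ => ENNReal.ofReal_lt_top)]
    simp only [ENNReal.toReal_ofReal (vandSq_nonneg _), smul_eq_mul, ENNReal.toReal_inv,
      ENNReal.toReal_ofReal hI0.le]
    have : ∀ l : Fin n → ℝ, G l * (c * vandSq l) = c * (vandSq l * G l) := fun l => by ring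
    simp only [this, integral_const_mul]
    rw [← hD]
    field_simp

/-- The variance of a bounded linear statistic in terms of the compressed multiplication
operators. -/
lemma variance_linStat_OPE (hmom : HasAllMoments μ) {p : ℕ → Polynomial ℝ}
    (hp : IsOrthonormalPolys μ p) (n : ℕ) {h : ℝ → ℝ} (hm : Measurable h) {C : ℝ}
    (hC : ∀ x, |h x| ≤ C) :
    variance (fun l : Fin n → ℝ => linStat h l) (OPE μ n)
      = ∑ j : Fin n, ∫ x, h x ^ 2 * ((p j).eval x * (p j).eval x) ∂μ
        - ∑ j : Fin n, ∑ k : Fin n, (∫ x, h x * ((p j).eval x * (p k).eval x) ∂μ) ^ 2 := by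
  obtain ⟨hprob, hOPE⟩ := isProbabilityMeasure_OPE_and_integral_OPE hmom hp n
  have hφ : ∀ j k : Fin n, Integrable (fun x => (p j).eval x * (p k).eval x) μ := fun j k => by
    simpa using integrable_eval hmom (p j * p k)
  have ho : ∀ j k : Fin n, ∫ x, (p j).eval x * (p k).eval x ∂μ = if j = k then 1 else 0 :=
    fun j k => by simpa [Fin.ext_iff] using hp.2.2 j k
  have hXm : Measurable fun l : Fin n → ℝ => linStat h l := by
    unfold linStat
    exact Finset.measurable_sum _ fun i _ => hm.comp (measurable_pi_apply i)
  have hX : MemLp (fun l : Fin n → ℝ => linStat h l) 2 (OPE μ n) := by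
    refine MemLp.of_bound hXm.aestronglyMeasurable (∑ _i : Fin n, C) (ae_of_all _ fun l => ?_)
    exact (Finset.abs_sum_le_sum_abs _ _).trans (Finset.sum_le_sum fun i _ => hC _)
  rw [variance_eq_sub hX]
  simp only [Pi.pow_apply, hOPE]
  rw [integral_linStat_mul_det_sq (φ := fun j : Fin n => fun x => (p j).eval x) hφ ho h
      (fun j k => integrable_bdd_mul_eval_mul_eval hmom hm hC _ _),
    integral_linStat_sq_mul_det_sq (φ := fun j : Fin n => fun x => (p j).eval x) hφ ho h
      (fun j k => integrable_bdd_mul_eval_mul_eval hmom hm hC _ _)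
      (fun j k => integrable_bdd_sq_mul_eval_mul_eval hmom hm hC _ _)]
  have hfac : (n.factorial : ℝ) ≠ 0 := by exact_mod_cast n.factorial_ne_zero
  rw [inv_mul_cancel_left₀ hfac, inv_mul_cancel_left₀ hfac]
  ring

/-- The mean square increment of `h` against the squared reproducing kernel. -/
lemma integral_sub_sq_mul_kernel_sq {φ : Fin n → ℝ → ℝ}
    (hφ : ∀ j k, Integrable (fun x => φ j x * φ k x) μ)
    (ho : ∀ j k, ∫ x, φ j x * φ k x ∂μ = if j = k then 1 else 0) {h : ℝ → ℝ}
    (hh : ∀ j k, Integrable (fun x => h x * (φ j x * φ k x)) μ)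
    (hh2 : ∀ j k, Integrable (fun x => h x ^ 2 * (φ j x * φ k x)) μ) :
    Integrable (fun z : ℝ × ℝ => (h z.1 - h z.2) ^ 2 * (∑ j, φ j z.1 * φ j z.2) ^ 2)
        (μ.prod μ) ∧
    ∫ z : ℝ × ℝ, (h z.1 - h z.2) ^ 2 * (∑ j, φ j z.1 * φ j z.2) ^ 2 ∂(μ.prod μ)
      = 2 * (∑ j, ∫ x, h x ^ 2 * (φ j x * φ j x) ∂μ
          - ∑ j, ∑ k, (∫ x, h x * (φ j x * φ k x) ∂μ) ^ 2) := by
  have hexp : ∀ z : ℝ × ℝ, (h z.1 - h z.2) ^ 2 * (∑ j, φ j z.1 * φ j z.2) ^ 2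
      = ∑ j, ∑ k, ((h z.1 ^ 2 * (φ j z.1 * φ k z.1)) * (φ j z.2 * φ k z.2)
        + (φ j z.1 * φ k z.1) * (h z.2 ^ 2 * (φ j z.2 * φ k z.2))
        - 2 * ((h z.1 * (φ j z.1 * φ k z.1)) * (h z.2 * (φ j z.2 * φ k z.2)))) := by
    intro z
    rw [sq (∑ j, φ j z.1 * φ j z.2), Finset.sum_mul_sum, Finset.mul_sum]
    refine Finset.sum_congr rfl fun j _ => ?_
    rw [Finset.mul_sum]
    refine Finset.sum_congr rfl fun k _ => ?_
    ring
  have i1 : ∀ j k, Integrable (fun z : ℝ × ℝ =>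
      (h z.1 ^ 2 * (φ j z.1 * φ k z.1)) * (φ j z.2 * φ k z.2)) (μ.prod μ) :=
    fun j k => (hh2 j k).mul_prod (hφ j k)
  have i2 : ∀ j k, Integrable (fun z : ℝ × ℝ =>
      (φ j z.1 * φ k z.1) * (h z.2 ^ 2 * (φ j z.2 * φ k z.2))) (μ.prod μ) :=
    fun j k => (hφ j k).mul_prod (hh2 j k)
  have i3 : ∀ j k, Integrable (fun z : ℝ × ℝ =>
      2 * ((h z.1 * (φ j z.1 * φ k z.1)) * (h z.2 * (φ j z.2 * φ k z.2)))) (μ.prod μ) :=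
    fun j k => ((hh j k).mul_prod (hh j k)).const_mul 2
  have i4 : ∀ j k, Integrable (fun z : ℝ × ℝ =>
      (h z.1 ^ 2 * (φ j z.1 * φ k z.1)) * (φ j z.2 * φ k z.2)
        + (φ j z.1 * φ k z.1) * (h z.2 ^ 2 * (φ j z.2 * φ k z.2))
        - 2 * ((h z.1 * (φ j z.1 * φ k z.1)) * (h z.2 * (φ j z.2 * φ k z.2)))) (μ.prod μ) :=
    fun j k => ((i1 j k).add (i2 j k)).sub (i3 j k)
  simp only [hexp]
  refine ⟨integrable_finsetSum _ fun j _ => integrable_finsetSum _ fun k _ =>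
    i4 j k, ?_⟩
  rw [integral_finsetSum _ fun j _ => integrable_finsetSum _ fun k _ => i4 j k]
  have hterm : ∀ j k, ∫ z : ℝ × ℝ, ((h z.1 ^ 2 * (φ j z.1 * φ k z.1)) * (φ j z.2 * φ k z.2)
        + (φ j z.1 * φ k z.1) * (h z.2 ^ 2 * (φ j z.2 * φ k z.2))
        - 2 * ((h z.1 * (φ j z.1 * φ k z.1)) * (h z.2 * (φ j z.2 * φ k z.2)))) ∂(μ.prod μ)
      = (if j = k then 2 * ∫ x, h x ^ 2 * (φ j x * φ k x) ∂μ else 0)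
        - 2 * (∫ x, h x * (φ j x * φ k x) ∂μ) ^ 2 := by
    intro j k
    rw [integral_sub (by exact (i1 j k).add (i2 j k)) (i3 j k), integral_add (i1 j k) (i2 j k),
      integral_const_mul,
      integral_prod_mul (fun x => h x ^ 2 * (φ j x * φ k x)) (fun x => φ j x * φ k x),
      integral_prod_mul (fun x => φ j x * φ k x) (fun x => h x ^ 2 * (φ j x * φ k x)),
      integral_prod_mul (fun x => h x * (φ j x * φ k x)) (fun x => h x * (φ j x * φ k x)), ho]
    split_ifs <;> ring
  simp only [fun j => integral_finsetSum Finset.univ fun k (_ : k ∈ Finset.univ) => i4 j k]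
  refine (Finset.sum_congr rfl fun j _ => Finset.sum_congr rfl fun k _ => hterm j k).trans ?_
  simp only [Finset.sum_sub_distrib, Finset.sum_ite_eq, Finset.mem_univ, if_true,
    ← Finset.mul_sum, mul_sub]

end Variance

section Jacobi

variable {μ : Measure ℝ} {p : ℕ → Polynomial ℝ}

lemma exists_eq_sum_C_mul (hp : IsOrthonormalPolys μ p) (m : ℕ) (q : Polynomial ℝ)
    (hq : q.degree < m) : ∃ c : ℕ → ℝ, q = ∑ k ∈ Finset.range m, Polynomial.C (c k) * p k := by
  induction m generalizing q with
  | zero => exact ⟨0, by simpa [Polynomial.degree_lt_iff_coeff_zero, Polynomial.ext_iff] using hq⟩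
  | succ m ih =>
    have hlc : (p m).coeff m ≠ 0 := by
      have := (hp.2.1 m).ne'
      rwa [Polynomial.leadingCoeff, Polynomial.natDegree_eq_of_degree_eq_some (hp.1 m)] at this
    set a := q.coeff m / (p m).coeff m with ha
    obtain ⟨c, hc⟩ := ih (q - Polynomial.C a * p m) (by
      rw [Polynomial.degree_lt_iff_coeff_zero] at hq ⊢
      intro k hk
      rcases hk.eq_or_lt with rfl | hk
      · simp [ha, hlc]
      · have : (p m).coeff k = 0 := Polynomial.coeff_eq_zero_of_degree_lt (by
          rw [hp.1]; exact_mod_cast hk)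
        simp [this, hq k hk])
    refine ⟨fun k => if k = m then a else c k, ?_⟩
    rw [Finset.sum_range_succ, ← sub_eq_iff_eq_add]
    simp only [if_true]
    rw [hc]
    refine Finset.sum_congr rfl fun k hk => ?_
    rw [if_neg (Finset.mem_range.1 hk).ne]

/-- Fourier coefficients and Parseval's identity for polynomials of degree less than `m`. -/
lemma parseval_of_degree_lt (hmom : HasAllMoments μ) (hp : IsOrthonormalPolys μ p) (m : ℕ)
    (q : Polynomial ℝ) (hq : q.degree < m) :
    q = ∑ k ∈ Finset.range m, Polynomial.C (∫ x, q.eval x * (p k).eval x ∂μ) * p k ∧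
    ∫ x, q.eval x ^ 2 ∂μ = ∑ k ∈ Finset.range m, (∫ x, q.eval x * (p k).eval x ∂μ) ^ 2 := by
  obtain ⟨c, hc⟩ := exists_eq_sum_C_mul hp m q hq
  have hintegrable : ∀ r s : Polynomial ℝ, Integrable (fun x => r.eval x * s.eval x) μ := fun r s => by
    simpa using integrable_eval hmom (r * s)
  have hlin : ∀ r : Polynomial ℝ, ∫ x, q.eval x * r.eval x ∂μ
      = ∑ k ∈ Finset.range m, c k * ∫ x, (p k).eval x * r.eval x ∂μ := by
    intro r
    have : ∀ x, q.eval x * r.eval x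
        = ∑ k ∈ Finset.range m, c k * ((p k).eval x * r.eval x) := by
      intro x
      conv_lhs => rw [hc]
      simp [Polynomial.eval_finsetSum, Finset.sum_mul, mul_assoc]
    simp only [this]
    rw [integral_finsetSum _ fun k _ => (hintegrable _ _).const_mul _]
    simp only [integral_const_mul]
  have hcoef : ∀ k ∈ Finset.range m, ∫ x, q.eval x * (p k).eval x ∂μ = c k := by
    intro k hk
    rw [hlin]
    simp only [hp.2.2, mul_ite, mul_one, mul_zero, Finset.sum_ite_eq', if_pos hk]
  constructor
  · conv_lhs => rw [hc]
    exact Finset.sum_congr rfl fun k hk => by rw [hcoef k hk]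
  · simp only [sq]
    rw [hlin]
    refine Finset.sum_congr rfl fun k hk => ?_
    rw [hcoef k hk, ← hcoef k hk]
    congr 1
    exact integral_congr_ae (ae_of_all _ fun x => mul_comm _ _)

/-- The compression of multiplication by `x` to polynomials of degree at most `m` loses exactly
the squared recurrence coefficient. -/
lemma sum_integral_sq_sub_sum_sq (hmom : HasAllMoments μ) (hp : IsOrthonormalPolys μ p) (m : ℕ) :
    ∑ j : Fin (m + 1), ∫ x, x ^ 2 * ((p j).eval x * (p j).eval x) ∂μ
      - ∑ j : Fin (m + 1), ∑ k : Fin (m + 1),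
        (∫ x, x * ((p j).eval x * (p k).eval x) ∂μ) ^ 2
      = ((p m).leadingCoeff / (p (m + 1)).leadingCoeff) ^ 2 := by
  have hdeg : ∀ j, (Polynomial.X * p j : Polynomial ℝ).degree = ((j + 1 : ℕ) : WithBot ℕ) := fun j => by
    rw [Polynomial.degree_mul, Polynomial.degree_X, hp.1, add_comm]
    rfl
  have e1 : ∀ j, ∫ x, x ^ 2 * ((p j).eval x * (p j).eval x) ∂μ
      = ∫ x, (Polynomial.X * p j : Polynomial ℝ).eval x ^ 2 ∂μ := fun j =>
    integral_congr_ae (ae_of_all _ fun x => by simp; ring)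
  have e2 : ∀ j k, ∫ x, x * ((p j).eval x * (p k).eval x) ∂μ
      = ∫ x, (Polynomial.X * p j : Polynomial ℝ).eval x * (p k).eval x ∂μ := fun j k =>
    integral_congr_ae (ae_of_all _ fun x => by simp; ring)
  simp only [e1, e2]
  rw [Fin.sum_univ_eq_sum_range (fun j => ∫ x, (Polynomial.X * p j : Polynomial ℝ).eval x ^ 2 ∂μ)]
  simp only [fun j => Fin.sum_univ_eq_sum_range
    (fun k => (∫ x, (Polynomial.X * p j : Polynomial ℝ).eval x * (p k).eval x ∂μ) ^ 2) (m + 1)]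
  rw [Fin.sum_univ_eq_sum_range (fun j => ∑ k ∈ Finset.range (m + 1),
    (∫ x, (Polynomial.X * p j : Polynomial ℝ).eval x * (p k).eval x ∂μ) ^ 2), Finset.sum_range_succ,
    Finset.sum_range_succ _ m]
  have hlow : ∀ j ∈ Finset.range m, ∫ x, (Polynomial.X * p j : Polynomial ℝ).eval x ^ 2 ∂μ
      = ∑ k ∈ Finset.range (m + 1),
        (∫ x, (Polynomial.X * p j : Polynomial ℝ).eval x * (p k).eval x ∂μ) ^ 2 := fun j hj =>
    (parseval_of_degree_lt hmom hp (m + 1) _ (by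
      rw [hdeg]; exact_mod_cast Nat.succ_lt_succ (Finset.mem_range.1 hj))).2
  obtain ⟨htop, hpars⟩ := parseval_of_degree_lt hmom hp (m + 2) (Polynomial.X * p m) (by
      rw [hdeg]; exact_mod_cast Nat.lt_succ_self _)
  rw [Finset.sum_congr rfl hlow, hpars, Finset.sum_range_succ _ (m + 1)]
  have hlead : ∀ k, (p k).leadingCoeff = (p k).coeff k := fun k => by
    rw [Polynomial.leadingCoeff, Polynomial.natDegree_eq_of_degree_eq_some (hp.1 k)]
  have hcoeff := congrArg (fun q : Polynomial ℝ => q.coeff (m + 1)) htop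
  simp only [Polynomial.coeff_X_mul, Polynomial.finsetSum_coeff, Polynomial.coeff_C_mul] at hcoeff
  rw [Finset.sum_range_succ, Finset.sum_eq_zero, zero_add, ← hlead, ← hlead] at hcoeff
  · rw [hcoeff, mul_div_cancel_right₀ _ (hp.2.1 (m + 1)).ne']
    ring
  · intro k hk
    rw [Polynomial.coeff_eq_zero_of_degree_lt, mul_zero]
    rw [hp.1]
    exact_mod_cast Finset.mem_range.1 hk

end Jacobi

/-- If `(f x - f y)² ≤ ε + κ (x - y)²`, the variance of the linear statistic of `f` is controlled
by the size of the ensemble and by the recurrence coefficient. -/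
lemma variance_linStat_OPE_le {μ : Measure ℝ} [IsProbabilityMeasure μ] (hmom : HasAllMoments μ)
    {p : ℕ → Polynomial ℝ} (hp : IsOrthonormalPolys μ p) {f : ℝ → ℝ} (hm : Measurable f) {C : ℝ}
    (hC : ∀ x, |f x| ≤ C) {ε κ : ℝ}
    (hf : ∀ x y, (f x - f y) ^ 2 ≤ ε + κ * (x - y) ^ 2) {n : ℕ} (hn : n ≠ 0) :
    variance (fun l : Fin n → ℝ => linStat f l) (OPE μ n)
      ≤ ε / 2 * n + κ * ((p (n - 1)).leadingCoeff / (p n).leadingCoeff) ^ 2 := by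
  obtain ⟨m, rfl⟩ := Nat.exists_eq_succ_of_ne_zero hn
  simp only [Nat.succ_eq_add_one, Nat.add_sub_cancel]
  rw [variance_linStat_OPE hmom hp (m + 1) hm hC, ← sum_integral_sq_sub_sum_sq hmom hp m]
  set φ : Fin (m + 1) → ℝ → ℝ := fun j x => (p j).eval x with hφdef
  have hφ : ∀ j k, Integrable (fun x => φ j x * φ k x) μ := fun j k => by
    simpa using integrable_eval hmom (p j * p k)
  have ho : ∀ j k, ∫ x, φ j x * φ k x ∂μ = if j = k then 1 else 0 :=
    fun j k => by simpa [Fin.ext_iff] using hp.2.2 j k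
  obtain ⟨fi, fe⟩ := integral_sub_sq_mul_kernel_sq hφ ho (h := f)
    (fun j k => integrable_bdd_mul_eval_mul_eval hmom hm hC _ _)
    (fun j k => integrable_bdd_sq_mul_eval_mul_eval hmom hm hC _ _)
  obtain ⟨xi, xe⟩ := integral_sub_sq_mul_kernel_sq hφ ho (h := fun x => x)
    (fun j k =>
      (integrable_eval hmom (Polynomial.X * (p j * p k) : Polynomial ℝ)).congr
        (ae_of_all _ fun x => by simp [hφdef]))
    (fun j k =>
      (integrable_eval hmom (Polynomial.X ^ 2 * (p j * p k) : Polynomial ℝ)).congr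
        (ae_of_all _ fun x => by simp [hφdef]))
  have hK : ∀ z : ℝ × ℝ, (∑ j, φ j z.1 * φ j z.2) ^ 2
      = ∑ j, ∑ k, (φ j z.1 * φ k z.1) * (φ j z.2 * φ k z.2) := by
    intro z
    rw [sq, Finset.sum_mul_sum]
    exact Finset.sum_congr rfl fun j _ => Finset.sum_congr rfl fun k _ => by ring
  have hKi : ∀ j k, Integrable
      (fun z : ℝ × ℝ => (φ j z.1 * φ k z.1) * (φ j z.2 * φ k z.2)) (μ.prod μ) :=
    fun j k => (hφ j k).mul_prod (hφ j k)
  have ki : Integrable (fun z : ℝ × ℝ => (∑ j, φ j z.1 * φ j z.2) ^ 2) (μ.prod μ) := by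
    simp only [hK]
    exact integrable_finsetSum _ fun j _ => integrable_finsetSum _ fun k _ => hKi j k
  have ke : ∫ z : ℝ × ℝ, (∑ j, φ j z.1 * φ j z.2) ^ 2 ∂(μ.prod μ) = ((m + 1 : ℕ) : ℝ) := by
    simp only [hK]
    rw [integral_finsetSum _ fun j _ => integrable_finsetSum _ fun k _ => hKi j k]
    simp only [fun j => integral_finsetSum Finset.univ fun k (_ : k ∈ Finset.univ) => hKi j k,
      fun j k => integral_prod_mul (μ := μ) (ν := μ) (fun x => φ j x * φ k x)
        (fun x => φ j x * φ k x), ho]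
    simp
  have hle := integral_mono fi ((ki.const_mul ε).add (xi.const_mul κ)) (fun z => by
    have h1 := mul_le_mul_of_nonneg_right (hf z.1 z.2) (sq_nonneg (∑ j, φ j z.1 * φ j z.2))
    simp only [Pi.add_apply]
    linarith)
  simp only [Pi.add_apply] at hle
  rw [integral_add (ki.const_mul ε) (xi.const_mul κ), integral_const_mul, integral_const_mul,
    fe, ke, xe] at hle
  linarith

lemma sq_sub_le_of_uniformContinuous {f : ℝ → ℝ} (hf : UniformContinuous f) {C : ℝ}
    (hC : ∀ x, |f x| ≤ C) {ε : ℝ} (hε : 0 < ε) :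
    ∃ κ : ℝ, ∀ x y, (f x - f y) ^ 2 ≤ ε + κ * (x - y) ^ 2 := by
  obtain ⟨δ, hδ, h⟩ := Metric.uniformContinuous_iff.1 hf (√ε) (Real.sqrt_pos.2 hε)
  refine ⟨(2 * C) ^ 2 / δ ^ 2, fun x y => ?_⟩
  rcases lt_or_ge (dist x y) δ with hxy | hxy
  · have h1 := h hxy
    rw [Real.dist_eq] at h1
    have h2 : (f x - f y) ^ 2 ≤ ε := by
      rw [← sq_abs, ← Real.sq_sqrt hε.le]
      exact pow_le_pow_left₀ (abs_nonneg _) h1.le 2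
    have : 0 ≤ (2 * C) ^ 2 / δ ^ 2 * (x - y) ^ 2 := by positivity
    linarith
  · have h1 : |f x - f y| ≤ 2 * C := by
      linarith [abs_sub (f x) (f y), hC x, hC y]
    have h2 : (f x - f y) ^ 2 ≤ (2 * C) ^ 2 := by
      rw [← sq_abs]
      exact pow_le_pow_left₀ (abs_nonneg _) h1 2
    have h3 : 1 ≤ (x - y) ^ 2 / δ ^ 2 := by
      rw [one_le_div (by positivity), ← sq_abs (x - y)]
      exact pow_le_pow_left₀ hδ.le (by rwa [Real.dist_eq] at hxy) 2
    have h4 := mul_le_mul_of_nonneg_left h3 (sq_nonneg (2 * C))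
    have h5 : (2 * C) ^ 2 / δ ^ 2 * (x - y) ^ 2 = (2 * C) ^ 2 * ((x - y) ^ 2 / δ ^ 2) := by ring
    linarith

/-- **Variance is `o(n)` for varying measures** (Proposition 4.2, third part): if
`(1/n)(γ_{n-1}^{(n)}/γ_n^{(n)})² → 0`, then for every uniformly continuous bounded `f`,
`Var X_f^{(n)} = o(n)` as `n → ∞`, where the OPE of size `n` is taken w.r.t. `μ_n`. -/
theorem variance_little_o_varying
    (μ : ℕ → Measure ℝ) (hprob : ∀ n, IsProbabilityMeasure (μ n))
    (hinf : ∀ n, InfiniteSupport (μ n)) (hmom : ∀ n, HasAllMoments (μ n))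
    (p : ℕ → ℕ → Polynomial ℝ) (hp : ∀ n, IsOrthonormalPolys (μ n) (p n))
    (hγ : Tendsto (fun n : ℕ =>
        (1 / (n : ℝ)) * ((p n (n - 1)).leadingCoeff / (p n n).leadingCoeff) ^ 2)
      atTop (𝓝 0))
    (f : ℝ → ℝ) (hf : UniformContinuous f) (hfb : ∃ C : ℝ, ∀ x, |f x| ≤ C) :
    Tendsto (fun n : ℕ =>
        variance (fun l : Fin n → ℝ => linStat f l) (OPE (μ n) n) / n) atTop (𝓝 0) := by
  obtain ⟨C, hC⟩ := hfb
  rw [Metric.tendsto_atTop]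
  intro ε hε
  obtain ⟨κ, hκ⟩ := sq_sub_le_of_uniformContinuous hf hC hε
  have hlim := hγ.const_mul κ
  rw [mul_zero] at hlim
  obtain ⟨N, hN⟩ := eventually_atTop.1
    ((hlim.eventually (gt_mem_nhds (half_pos hε))).and (eventually_gt_atTop 0))
  refine ⟨N, fun n hn => ?_⟩
  obtain ⟨hlt, hn0⟩ := hN n hn
  have := hprob n
  have hpos : (0 : ℝ) < n := by exact_mod_cast hn0
  have hvar := variance_linStat_OPE_le (hmom n) (hp n) hf.continuous.measurable hC hκ hn0.ne'
  rw [Real.dist_eq, sub_zero,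
    abs_of_nonneg (div_nonneg (variance_nonneg _ _) hpos.le), div_lt_iff₀ hpos]
  have h2 := mul_lt_mul_of_pos_right hlt hpos
  have h3 : κ * (1 / (n : ℝ) * ((p n (n - 1)).leadingCoeff / (p n n).leadingCoeff) ^ 2) * n
      = κ * ((p n (n - 1)).leadingCoeff / (p n n).leadingCoeff) ^ 2 := by
    field_simp
  linarith
end
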